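/- (Reverse triangular inequality for merging size.) Let P1, P2, P3 be paradigms over finite nonempty index sets. Then |msize(P1, P2) − msize(P2, P3)| ≤ msize(P1, P3). -/

import Mathlib

/-- The size of a paradigm `P : I → Fin n → α`: the sum over columns of the metric
diameter of the column set `P[i] = {P s i : s ∈ I}`. -/
noncomputable def psize {α : Type*} [PseudoMetricSpace α] {I : Type*} {n : ℕ}
    (P : I → Fin n → α) : ℝ :=
  ∑ i : Fin n, Metric.diam (Set.range fun s => P s i)

/-- `Q` is a column-insertion of `P`: there is a strictly monotone map `f` of the columns
of `P` into the columns of `Q` such that `Q` agrees with `P` along `f` and is `null`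
on all other columns. -/
def IsColInsertion {α : Type*} (null : α) {I : Type*} {n m : ℕ}
    (Q : I → Fin m → α) (P : I → Fin n → α) : Prop :=
  ∃ f : Fin n → Fin m, StrictMono f ∧
    (∀ s i, Q s (f i) = P s i) ∧
    ∀ s j, j ∉ Set.range f → Q s j = null

/-- `Q` is a merged paradigm of `P1` and `P2`: its restriction to `I1` is a
column-insertion of `P1` and its restriction to `I2` is a column-insertion of `P2`. -/
def IsMergedParadigm {α : Type*} (null : α) {I1 I2 : Type*} {n1 n2 m : ℕ}
    (P1 : I1 → Fin n1 → α) (P2 : I2 → Fin n2 → α) (Q : I1 ⊕ I2 → Fin m → α) : Prop :=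
  IsColInsertion null (fun s => Q (Sum.inl s)) P1 ∧
  IsColInsertion null (fun s => Q (Sum.inr s)) P2

/-- The merging size `msize(P1, P2)`: the infimum of `size(Q)` over all merged
paradigms `Q` of `P1` and `P2`. -/
noncomputable def msize {α : Type*} [PseudoMetricSpace α] (null : α) {I1 I2 : Type*}
    {n1 n2 : ℕ} (P1 : I1 → Fin n1 → α) (P2 : I2 → Fin n2 → α) : ℝ :=
  sInf {r : ℝ | ∃ (m : ℕ) (Q : I1 ⊕ I2 → Fin m → α),
    IsMergedParadigm null P1 P2 Q ∧ psize Q = r}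

/-- Column-insertions are exactly the extensions by `null` along strictly monotone maps. -/
theorem isColInsertion_iff_extend {α : Type*} (null : α) {I : Type*} {n m : ℕ}
    (Q : I → Fin m → α) (P : I → Fin n → α) :
    IsColInsertion null Q P ↔
      ∃ f : Fin n → Fin m, StrictMono f ∧ ∀ s, Q s = Function.extend f (P s) fun _ => null := by
  constructor
  · rintro ⟨f, hf, h1, h2⟩
    refine ⟨f, hf, fun s => funext fun j => ?_⟩
    by_cases hj : j ∈ Set.range f
    · obtain ⟨i, rfl⟩ := hj
      rw [h1, hf.injective.extend_apply]
    · rw [h2 s j hj, Function.extend_apply' _ _ _ hj]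
  · rintro ⟨f, hf, h⟩
    refine ⟨f, hf, fun s i => ?_, fun s j hj => ?_⟩
    · rw [h, hf.injective.extend_apply]
    · rw [h, Function.extend_apply' _ _ _ hj]

theorem extend_extend_const {ι κ μ α : Type*} {f : ι → κ} {g : κ → μ}
    (hf : Function.Injective f) (hg : Function.Injective g) (p : ι → α) (a : α) :
    Function.extend g (Function.extend f p fun _ => a) (fun _ => a) =
      Function.extend (g ∘ f) p fun _ => a := by
  funext x
  by_cases hx : ∃ k, g k = x
  · obtain ⟨k, rfl⟩ := hx
    rw [hg.extend_apply]
    by_cases hk : ∃ i, f i = k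
    · obtain ⟨i, rfl⟩ := hk
      rw [hf.extend_apply, ← Function.comp_apply (f := g), (hg.comp hf).extend_apply]
    · rw [Function.extend_apply' _ _ _ hk, Function.extend_apply']
      rintro ⟨i, hi⟩
      exact hk ⟨i, hg hi⟩
  · rw [Function.extend_apply' _ _ _ hx, Function.extend_apply']
    rintro ⟨i, hi⟩
    exact hx ⟨f i, hi⟩

theorem psize_nonneg {α : Type*} [PseudoMetricSpace α] {I : Type*} {n : ℕ}
    (P : I → Fin n → α) : 0 ≤ psize P :=
  Finset.sum_nonneg fun _ _ => Metric.diam_nonneg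

/-- Inserting `null` columns does not change the size. -/
theorem psize_extend {α : Type*} [PseudoMetricSpace α] (null : α) {I : Type*} {n m : ℕ}
    {f : Fin n → Fin m} (hf : Function.Injective f) (P : I → Fin n → α) :
    psize (fun s => Function.extend f (P s) fun _ => null) = psize P := by
  symm
  refine Finset.sum_of_injOn f hf.injOn (by simp) (fun j _ hj => ?_) fun i _ => ?_
  · have hj' : ¬ ∃ i, f i = j := by simpa using hj
    simp only [Function.extend_apply' _ _ _ hj']
    exact Metric.diam_subsingleton (Set.subsingleton_singleton.anti Set.range_const_subset)
  · simp only [hf.extend_apply]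

/-- The size of a paradigm does not depend on the labelling of its rows. -/
theorem psize_comp_equiv {α : Type*} [PseudoMetricSpace α] {I J : Type*} {n : ℕ}
    (e : J ≃ I) (P : I → Fin n → α) : psize (fun s => P (e s)) = psize P :=
  Finset.sum_congr rfl fun i _ =>
    congrArg Metric.diam (e.surjective.range_comp fun s => P s i)

/-- A strictly monotone `h : Fin n → Fin p` can be followed by a strictly monotone map so that
the composite no longer depends on `h`. -/
theorem exists_strictMono_apply_eq_mul {n p M : ℕ} {h : Fin n → Fin p} (hh : StrictMono h)
    (hM : p < M) :
    ∃ h' : Fin p → Fin ((n + 1) * M), StrictMono h' ∧ ∀ i, (h' (h i) : ℕ) = (i + 1) * M := by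
  classical
  let c : Fin p → ℕ := fun j => (Finset.univ.filter fun i => h i ≤ j).card
  let r : Fin p → ℕ := fun j => if j ∈ Set.range h then 0 else j + 1
  have hc : ∀ j, c j ≤ n := fun j => (Finset.card_le_univ _).trans_eq (Fintype.card_fin n)
  have hr : ∀ j, r j < M := fun j => by
    dsimp only [r]
    split_ifs <;> omega
  refine ⟨fun j => ⟨c j * M + r j, ?_⟩, fun j j' hjj => ?_, fun i => ?_⟩
  · nlinarith [Nat.mul_le_mul_right M (hc j), hr j]
  · have hsub : (Finset.univ.filter fun i => h i ≤ j) ⊆ Finset.univ.filter fun i => h i ≤ j' :=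
      Finset.monotone_filter_right _ fun i _ hi => hi.trans hjj.le
    rw [Fin.mk_lt_mk]
    rcases (Finset.card_le_card hsub).lt_or_eq with hlt | heq
    · have := Nat.mul_le_mul_right M (Nat.succ_le_of_lt hlt)
      have := hr j
      simp only [c]
      nlinarith
    · have hj' : j' ∉ Set.range h := by
        rintro ⟨i, rfl⟩
        have hi : i ∈ Finset.univ.filter fun i => h i ≤ j := by
          rw [Finset.eq_of_subset_of_card_le hsub heq.ge]
          simp
        exact hjj.not_ge (Finset.mem_filter.1 hi).2
      have hrr : r j < r j' := by
        simp only [r, if_neg hj']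
        split_ifs <;> omega
      have hcc : c j = c j' := heq
      rw [hcc]
      omega
  · have hci : c (h i) = i + 1 := by
      simp only [c, hh.le_iff_le]
      rw [Finset.filter_ge_eq_Iic, Fin.card_Iic]
    simp [hci, r]

/-- Two strictly monotone maps out of `Fin n` can be completed to a commutative square of
strictly monotone maps. -/
theorem exists_strictMono_comp_eq_comp {n m k : ℕ} {f : Fin n → Fin m} {g : Fin n → Fin k}
    (hf : StrictMono f) (hg : StrictMono g) :
    ∃ (N : ℕ) (f' : Fin m → Fin N) (g' : Fin k → Fin N),
      StrictMono f' ∧ StrictMono g' ∧ f' ∘ f = g' ∘ g := by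
  obtain ⟨f', hf', hff⟩ := exists_strictMono_apply_eq_mul (M := m + k + 1) hf (by omega)
  obtain ⟨g', hg', hgg⟩ := exists_strictMono_apply_eq_mul (M := m + k + 1) hg (by omega)
  exact ⟨_, f', g', hf', hg', funext fun i => Fin.ext ((hff i).trans (hgg i).symm)⟩

/-- The triangle inequality for merged paradigms sharing their middle paradigm. -/
theorem exists_isMergedParadigm_psize_le {α : Type*} [PseudoMetricSpace α] (null : α)
    {I1 I2 I3 : Type*} [Finite I1] [Finite I2] [Nonempty I2] [Finite I3]
    {n1 n2 n3 m k : ℕ}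
    {P1 : I1 → Fin n1 → α} {P2 : I2 → Fin n2 → α} {P3 : I3 → Fin n3 → α}
    {Q : I1 ⊕ I2 → Fin m → α} {R : I2 ⊕ I3 → Fin k → α}
    (hQ : IsMergedParadigm null P1 P2 Q) (hR : IsMergedParadigm null P2 P3 R) :
    ∃ (N : ℕ) (S : I1 ⊕ I3 → Fin N → α),
      IsMergedParadigm null P1 P3 S ∧ psize S ≤ psize Q + psize R := by
  simp only [IsMergedParadigm, isColInsertion_iff_extend] at hQ hR ⊢
  obtain ⟨⟨a, ha, hQ1⟩, b, hb, hQ2⟩ := hQ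
  obtain ⟨⟨c, hc, hR2⟩, d, hd, hR3⟩ := hR
  obtain ⟨N, f, g, hf, hg, hfg⟩ := exists_strictMono_comp_eq_comp hb hc
  let Q' : I1 ⊕ I2 → Fin N → α := fun s => Function.extend f (Q s) fun _ => null
  let R' : I2 ⊕ I3 → Fin N → α := fun s => Function.extend g (R s) fun _ => null
  have hmid : ∀ s, Q' (Sum.inr s) = R' (Sum.inl s) := fun s => by
    simp only [Q', R', hQ2, hR2, extend_extend_const hb.injective hf.injective,
      extend_extend_const hc.injective hg.injective, hfg]
  refine ⟨N, Sum.elim (fun s => Q' (Sum.inl s)) (fun s => R' (Sum.inr s)),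
    ⟨⟨f ∘ a, hf.comp ha, fun s => ?_⟩, ⟨g ∘ d, hg.comp hd, fun s => ?_⟩⟩, ?_⟩
  · simp only [Sum.elim_inl, Q', hQ1, extend_extend_const ha.injective hf.injective]
  · simp only [Sum.elim_inr, R', hR3, extend_extend_const hd.injective hg.injective]
  · rw [← psize_extend null hf.injective Q, ← psize_extend null hg.injective R]
    change _ ≤ psize Q' + psize R'
    unfold psize
    rw [← Finset.sum_add_distrib]
    refine Finset.sum_le_sum fun x _ => ?_
    have hQd : ∀ s t, dist (Q' s x) (Q' t x) ≤ Metric.diam (Set.range fun s => Q' s x) :=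
      fun s t => Metric.dist_le_diam_of_mem (Set.finite_range _).isBounded ⟨s, rfl⟩ ⟨t, rfl⟩
    have hRd : ∀ s t, dist (R' s x) (R' t x) ≤ Metric.diam (Set.range fun s => R' s x) :=
      fun s t => Metric.dist_le_diam_of_mem (Set.finite_range _).isBounded ⟨s, rfl⟩ ⟨t, rfl⟩
    have hQ0 : 0 ≤ Metric.diam (Set.range fun s => Q' s x) := Metric.diam_nonneg
    have hR0 : 0 ≤ Metric.diam (Set.range fun s => R' s x) := Metric.diam_nonneg
    obtain ⟨u⟩ := ‹Nonempty I2›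
    have hcross : ∀ s t, dist (Q' (Sum.inl s) x) (R' (Sum.inr t) x) ≤
        Metric.diam (Set.range fun s => Q' s x) + Metric.diam (Set.range fun s => R' s x) := by
      intro s t
      refine (dist_triangle _ (Q' (Sum.inr u) x) _).trans (add_le_add (hQd _ _) ?_)
      rw [hmid u]
      exact hRd _ _
    refine Metric.diam_le_of_forall_dist_le (add_nonneg hQ0 hR0) ?_
    rintro _ ⟨s | s, rfl⟩ _ ⟨t | t, rfl⟩
    · exact (hQd _ _).trans (le_add_of_nonneg_right hR0)
    · exact hcross s t
    · rw [dist_comm]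
      exact hcross t s
    · exact (hRd _ _).trans (le_add_of_nonneg_left hQ0)

theorem exists_isMergedParadigm {α : Type*} (null : α) {I1 I2 : Type*} {n1 n2 : ℕ}
    (P1 : I1 → Fin n1 → α) (P2 : I2 → Fin n2 → α) :
    ∃ (m : ℕ) (Q : I1 ⊕ I2 → Fin m → α), IsMergedParadigm null P1 P2 Q := by
  simp only [IsMergedParadigm, isColInsertion_iff_extend]
  exact ⟨max n1 n2, Sum.elim
    (fun s => Function.extend (Fin.castLE (le_max_left n1 n2)) (P1 s) fun _ => null)
    (fun s => Function.extend (Fin.castLE (le_max_right n1 n2)) (P2 s) fun _ => null),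
    ⟨_, Fin.strictMono_castLE _, fun _ => rfl⟩, ⟨_, Fin.strictMono_castLE _, fun _ => rfl⟩⟩

theorem msize_le_psize {α : Type*} [PseudoMetricSpace α] (null : α) {I1 I2 : Type*}
    {n1 n2 m : ℕ} {P1 : I1 → Fin n1 → α} {P2 : I2 → Fin n2 → α} {Q : I1 ⊕ I2 → Fin m → α}
    (hQ : IsMergedParadigm null P1 P2 Q) : msize null P1 P2 ≤ psize Q := by
  refine csInf_le ⟨0, ?_⟩ ⟨m, Q, hQ, rfl⟩
  rintro _ ⟨_, R, _, rfl⟩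
  exact psize_nonneg R

theorem le_msize {α : Type*} [PseudoMetricSpace α] (null : α) {I1 I2 : Type*}
    {n1 n2 : ℕ} (P1 : I1 → Fin n1 → α) (P2 : I2 → Fin n2 → α) {r : ℝ}
    (h : ∀ (m : ℕ) (Q : I1 ⊕ I2 → Fin m → α), IsMergedParadigm null P1 P2 Q → r ≤ psize Q) :
    r ≤ msize null P1 P2 := by
  obtain ⟨m, Q, hQ⟩ := exists_isMergedParadigm null P1 P2
  refine le_csInf ⟨_, m, Q, hQ, rfl⟩ ?_
  rintro _ ⟨k, R, hR, rfl⟩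
  exact h k R hR

theorem msize_le_msize_swap {α : Type*} [PseudoMetricSpace α] (null : α) {I1 I2 : Type*}
    {n1 n2 : ℕ} (P1 : I1 → Fin n1 → α) (P2 : I2 → Fin n2 → α) :
    msize null P1 P2 ≤ msize null P2 P1 := by
  refine le_msize null P2 P1 fun m Q hQ => ?_
  rw [← psize_comp_equiv (Equiv.sumComm I1 I2) Q]
  exact msize_le_psize null ⟨hQ.2, hQ.1⟩

theorem msize_comm {α : Type*} [PseudoMetricSpace α] (null : α) {I1 I2 : Type*}
    {n1 n2 : ℕ} (P1 : I1 → Fin n1 → α) (P2 : I2 → Fin n2 → α) :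
    msize null P1 P2 = msize null P2 P1 :=
  (msize_le_msize_swap null P1 P2).antisymm (msize_le_msize_swap null P2 P1)

/-- The triangle inequality for the merging size. -/
theorem msize_triangle {α : Type*} [PseudoMetricSpace α] (null : α)
    {I1 I2 I3 : Type*} [Finite I1] [Finite I2] [Nonempty I2] [Finite I3] {n1 n2 n3 : ℕ}
    (P1 : I1 → Fin n1 → α) (P2 : I2 → Fin n2 → α) (P3 : I3 → Fin n3 → α) :
    msize null P1 P3 ≤ msize null P1 P2 + msize null P2 P3 := by
  rw [← sub_le_iff_le_add]
  refine le_msize null P1 P2 fun m Q hQ => ?_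
  rw [sub_le_comm]
  refine le_msize null P2 P3 fun k R hR => ?_
  obtain ⟨N, S, hS, hle⟩ := exists_isMergedParadigm_psize_le null hQ hR
  exact sub_le_iff_le_add'.2 ((msize_le_psize null hS).trans hle)

/-- **Reverse triangular inequality for merging size.**
`|msize(P1, P2) − msize(P2, P3)| ≤ msize(P1, P3)`. -/
theorem msize_abs_sub_le {α : Type*} [PseudoMetricSpace α] (null : α)
    {I1 I2 I3 : Type*} [Fintype I1] [Nonempty I1] [Fintype I2] [Nonempty I2]
    [Fintype I3] [Nonempty I3] {n1 n2 n3 : ℕ}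
    (P1 : I1 → Fin n1 → α) (P2 : I2 → Fin n2 → α) (P3 : I3 → Fin n3 → α) :
    |msize null P1 P2 - msize null P2 P3| ≤ msize null P1 P3 := by
  have h1 := msize_triangle null P1 P3 P2
  have h2 := msize_triangle null P2 P1 P3
  rw [msize_comm null P3 P2] at h1
  rw [msize_comm null P2 P1] at h2
  rw [abs_le]
  constructor <;> linarith
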